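/- Let W ∈ ∂θ(P) with P ≠ 0. If H ∈ C_{θ*}(W,P) and φ*_{(W,H)}(P) = 0, then H belongs to the polar cone (C_θ(P,W))°. (The converse implication is false in general.) -/

import Mathlib

open Matrix Filter Set RealInnerProductSpace

noncomputable section

/-- Trace inner product on real matrices: `⟨A,B⟩ = trace (Aᵀ B)`. -/
def minner {ι κ : Type*} [Fintype ι] [Fintype κ] (A B : Matrix ι κ ℝ) : ℝ :=
  (Aᵀ * B).trace

/-- Frobenius norm. -/
def fnorm {ι κ : Type*} [Fintype ι] [Fintype κ] (A : Matrix ι κ ℝ) : ℝ :=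
  Real.sqrt (minner A A)

/-- Spectral norm (largest singular value), as the ℓ²-operator norm. -/
def specNorm {ι κ : Type*} [Fintype ι] [Fintype κ] (A : Matrix ι κ ℝ) : ℝ :=
  sSup {r : ℝ | ∃ x : κ → ℝ, ∑ j, x j ^ 2 = 1 ∧
    r = Real.sqrt (∑ i, (∑ j, A i j * x j) ^ 2)}

/-- Convex subdifferential with respect to the trace inner product. -/
def subdiff {ι κ : Type*} [Fintype ι] [Fintype κ] (f : Matrix ι κ ℝ → ℝ)
    (X : Matrix ι κ ℝ) : Set (Matrix ι κ ℝ) :=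
  {G | ∀ Y, f X + minner G (Y - X) ≤ f Y}

/-- One-sided directional derivative. -/
def dirDeriv {ι κ : Type*} [Fintype ι] [Fintype κ] (f : Matrix ι κ ℝ → ℝ)
    (X D : Matrix ι κ ℝ) : ℝ :=
  limUnder (nhdsWithin (0 : ℝ) (Set.Ioi 0)) fun t => (f (X + t • D) - f X) / t

/-- Critical cone of the spectral norm θ at `P` for `W`. -/
def critTheta {ι κ : Type*} [Fintype ι] [Fintype κ] (P W : Matrix ι κ ℝ) :
    Set (Matrix ι κ ℝ) :=
  {D | dirDeriv specNorm P D = minner D W}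

/-- Conjugate θ* of the spectral norm, as an extended-real-valued function
(it is the indicator of the nuclear norm unit ball). -/
def thetaStar {ι κ : Type*} [Fintype ι] [Fintype κ] (W : Matrix ι κ ℝ) : EReal :=
  ⨆ X : Matrix ι κ ℝ, ((minner W X - specNorm X : ℝ) : EReal)

/-- Lower directional epiderivative of an extended-real-valued function. -/
def epiDeriv {ι κ : Type*} [Fintype ι] [Fintype κ] (g : Matrix ι κ ℝ → EReal)
    (X D : Matrix ι κ ℝ) : EReal :=
  liminf (fun p : ℝ × Matrix ι κ ℝ =>
      (((p.1)⁻¹ : ℝ) : EReal) * (g (X + p.1 • p.2) - g X))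
    ((nhdsWithin (0 : ℝ) (Set.Ioi 0)) ×ˢ nhds D)

/-- Critical cone of θ* at `W` for `P`. -/
def critThetaStar {ι κ : Type*} [Fintype ι] [Fintype κ] (W P : Matrix ι κ ℝ) :
    Set (Matrix ι κ ℝ) :=
  {D | epiDeriv thetaStar W D = ((minner D P : ℝ) : EReal)}

/-- Second-order directional derivative. -/
def dirDeriv2 {ι κ : Type*} [Fintype ι] [Fintype κ] (f : Matrix ι κ ℝ → ℝ)
    (X D W' : Matrix ι κ ℝ) : ℝ :=
  limUnder (nhdsWithin (0 : ℝ) (Set.Ioi 0)) fun t =>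
    (f (X + t • D + (t ^ 2 / 2) • W') - f X - t * dirDeriv f X D) / (t ^ 2 / 2)

/-- The sigma term of θ: `ψ*_{(P,D)}(W) = (θ''(P;D,·))*(W)`. -/
def sigmaTheta {ι κ : Type*} [Fintype ι] [Fintype κ] (P D W : Matrix ι κ ℝ) : EReal :=
  ⨆ Z : Matrix ι κ ℝ, ((minner W Z - dirDeriv2 specNorm P D Z : ℝ) : EReal)

/-- Lower second-order directional epiderivative of an EReal-valued function. -/
def epiDeriv2 {ι κ : Type*} [Fintype ι] [Fintype κ] (g : Matrix ι κ ℝ → EReal)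
    (X D W' : Matrix ι κ ℝ) : EReal :=
  liminf (fun p : ℝ × Matrix ι κ ℝ =>
      ((2 / p.1 ^ 2 : ℝ) : EReal) *
        (g (X + p.1 • D + (p.1 ^ 2 / 2) • p.2) - g X - (p.1 : ℝ) * epiDeriv g X D))
    ((nhdsWithin (0 : ℝ) (Set.Ioi 0)) ×ˢ nhds W')

/-- The sigma term of θ*: `φ*_{(W,H)}(P) = ((θ*)''(W;H,·))*(P)`. -/
def sigmaThetaStar {ι κ : Type*} [Fintype ι] [Fintype κ] (W H P : Matrix ι κ ℝ) : EReal :=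
  ⨆ Z : Matrix ι κ ℝ, (((minner P Z : ℝ) : EReal) - epiDeriv2 thetaStar W H Z)

/-- Polar cone with respect to the trace inner product. -/
def polarCone {ι κ : Type*} [Fintype ι] [Fintype κ] (K : Set (Matrix ι κ ℝ)) :
    Set (Matrix ι κ ℝ) :=
  {H | ∀ D ∈ K, minner H D ≤ 0}

/-- Rectangular diagonal matrix `[Diag σ  0]`. -/
def diagRect {m n : ℕ} (σ : Fin m → ℝ) : Matrix (Fin m) (Fin n) ℝ :=
  Matrix.of fun i j => if (j : ℕ) = (i : ℕ) then σ i else 0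

/-- Symmetric part `S(A₁)` of the left m×m block of an m×n matrix. -/
def symLeft {m n : ℕ} (hmn : m ≤ n) (A : Matrix (Fin m) (Fin n) ℝ) :
    Matrix (Fin m) (Fin m) ℝ :=
  Matrix.of fun i j => (A i (Fin.castLE hmn j) + A j (Fin.castLE hmn i)) / 2

/-- Skew-symmetric part `T(A₁)` of the left m×m block of an m×n matrix. -/
def skewLeft {m n : ℕ} (hmn : m ≤ n) (A : Matrix (Fin m) (Fin n) ℝ) :
    Matrix (Fin m) (Fin m) ℝ :=
  Matrix.of fun i j => (A i (Fin.castLE hmn j) - A j (Fin.castLE hmn i)) / 2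

/-- Quadratic form `xᵀ A x`. -/
def quadForm {m : ℕ} (A : Matrix (Fin m) (Fin m) ℝ) (x : Fin m → ℝ) : ℝ :=
  ∑ i, ∑ j, x i * A i j * x j

/-- Proximal mapping. -/
def prox {ι κ : Type*} [Fintype ι] [Fintype κ] (f : Matrix ι κ ℝ → ℝ)
    (Z : Matrix ι κ ℝ) : Matrix ι κ ℝ :=
  Classical.epsilon fun Y =>
    ∀ X, f Y + (1 / 2) * fnorm (Y - Z) ^ 2 ≤ f X + (1 / 2) * fnorm (X - Z) ^ 2

/-- Directional derivative of the proximal mapping. -/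
def proxDeriv {ι κ : Type*} [Fintype ι] [Fintype κ] (f : Matrix ι κ ℝ → ℝ)
    (Z D : Matrix ι κ ℝ) : Matrix ι κ ℝ :=
  limUnder (nhdsWithin (0 : ℝ) (Set.Ioi 0)) fun t =>
    t⁻¹ • (prox f (Z + t • D) - prox f Z)

end

section OperatorNorm

variable {E F : Type*} [NormedAddCommGroup E] [InnerProductSpace ℝ E]
  [NormedAddCommGroup F] [InnerProductSpace ℝ F]

/-- The top right-singular space of `A`: the vectors `x` with `A* A x = ‖A‖² x`. -/
def topSingularSpace (A : E →L[ℝ] F) : Submodule ℝ E where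
  carrier := {x | ∀ y, inner ℝ (A x) (A y) = ‖A‖ ^ 2 * inner ℝ x y}
  add_mem' := by
    intro a b ha hb y
    rw [map_add, inner_add_left, inner_add_left, ha y, hb y]
    ring
  zero_mem' := by intro y; simp
  smul_mem' := by
    intro c x hx y
    rw [map_smul, real_inner_smul_left, real_inner_smul_left, hx y]
    ring

theorem norm_apply_sq_le (A : E →L[ℝ] F) (x : E) : ‖A x‖ ^ 2 ≤ ‖A‖ ^ 2 * ‖x‖ ^ 2 := by
  rw [← mul_pow]
  exact pow_le_pow_left₀ (norm_nonneg _) (A.le_opNorm x) 2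

theorem norm_apply_sq_of_mem_topSingularSpace {A : E →L[ℝ] F} {x : E}
    (hx : x ∈ topSingularSpace A) : ‖A x‖ ^ 2 = ‖A‖ ^ 2 * ‖x‖ ^ 2 := by
  rw [← real_inner_self_eq_norm_sq (A x), ← real_inner_self_eq_norm_sq x]
  exact hx x

theorem mem_topSingularSpace_of_norm_apply_sq {A : E →L[ℝ] F} {x : E}
    (hx : ‖A x‖ ^ 2 = ‖A‖ ^ 2 * ‖x‖ ^ 2) : x ∈ topSingularSpace A := by
  intro y
  have hquad : ∀ t : ℝ, 0 ≤ (‖A‖ ^ 2 * ‖y‖ ^ 2 - ‖A y‖ ^ 2) * (t * t)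
      + 2 * (‖A‖ ^ 2 * inner ℝ x y - inner ℝ (A x) (A y)) * t + 0 := by
    intro t
    have h := norm_apply_sq_le A (x + t • y)
    rw [map_add, map_smul, norm_add_sq_real, norm_add_sq_real, real_inner_smul_right,
      real_inner_smul_right, norm_smul, norm_smul, mul_pow, mul_pow, Real.norm_eq_abs, sq_abs] at h
    nlinarith
  have hdisc := discrim_le_zero hquad
  rw [discrim] at hdisc
  nlinarith [sq_nonneg (‖A‖ ^ 2 * inner ℝ x y - inner ℝ (A x) (A y))]

/-- Spectral gap below the largest singular value. -/
theorem exists_gap_topSingularSpace [FiniteDimensional ℝ E] (A : E →L[ℝ] F) :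
    ∃ δ : ℝ, 0 < δ ∧ ∀ b ∈ (topSingularSpace A)ᗮ,
      ‖A b‖ ^ 2 ≤ (‖A‖ ^ 2 - δ) * ‖b‖ ^ 2 := by
  let S : Set E := Metric.sphere 0 1 ∩ ((topSingularSpace A)ᗮ : Submodule ℝ E)
  have hS : IsCompact S := (isCompact_sphere 0 1).inter_right (Submodule.isClosed_orthogonal _)
  obtain ⟨δ, hδ, hgap⟩ : ∃ δ : ℝ, 0 < δ ∧ ∀ b ∈ S, δ ≤ ‖A‖ ^ 2 - ‖A b‖ ^ 2 := by
    rcases S.eq_empty_or_nonempty with hempty | hne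
    · exact ⟨1, one_pos, by simp [hempty]⟩
    · obtain ⟨x, hx, hmin⟩ := hS.exists_isMinOn hne
        (f := fun b => ‖A‖ ^ 2 - ‖A b‖ ^ 2) (by fun_prop)
      refine ⟨‖A‖ ^ 2 - ‖A x‖ ^ 2, ?_, fun b hb => hmin hb⟩
      have hx1 : ‖x‖ = 1 := by simpa using hx.1
      have hle := norm_apply_sq_le A x
      rw [hx1, one_pow, mul_one] at hle
      refine sub_pos.2 (lt_of_le_of_ne hle fun heq => ?_)
      have hmem : x ∈ topSingularSpace A :=
        mem_topSingularSpace_of_norm_apply_sq (by rw [heq, hx1]; ring)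
      have hzero : inner ℝ x x = 0 := hx.2 x hmem
      rw [inner_self_eq_zero] at hzero
      simp [hzero] at hx1
  refine ⟨δ, hδ, fun b hb => ?_⟩
  rcases eq_or_ne b 0 with rfl | hb0
  · simp
  have hpos : 0 < ‖b‖ := norm_pos_iff.2 hb0
  have h := hgap (‖b‖⁻¹ • b) ⟨by simp [norm_smul, hpos.ne'], Submodule.smul_mem _ _ hb⟩
  rw [map_smul, norm_smul, mul_pow, norm_inv, norm_norm, inv_pow] at h
  have h2 : δ * ‖b‖ ^ 2 ≤ (‖A‖ ^ 2 - (‖b‖ ^ 2)⁻¹ * ‖A b‖ ^ 2) * ‖b‖ ^ 2 := by gcongr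
  have h3 : (‖b‖ ^ 2)⁻¹ * ‖A b‖ ^ 2 * ‖b‖ ^ 2 = ‖A b‖ ^ 2 := by field_simp
  nlinarith

/-- The directional derivative of the operator norm dominates the first-order variation on the
top singular space. -/
theorem inner_apply_le_of_mem_topSingularSpace (A B : E →L[ℝ] F) (hA : A ≠ 0) (d : ℝ)
    (hd : Tendsto (fun t : ℝ => (‖A + t • B‖ - ‖A‖) / t) (nhdsWithin 0 (Set.Ioi 0)) (nhds d))
    {a : E} (ha : a ∈ topSingularSpace A) :
    inner ℝ (A a) (B a) ≤ ‖A‖ * d * ‖a‖ ^ 2 := by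
  have hA' : 0 < ‖A‖ := norm_pos_iff.2 hA
  rcases eq_or_ne a 0 with rfl | ha0
  · simp
  have hpos : 0 < ‖a‖ := norm_pos_iff.2 ha0
  have hsq := norm_apply_sq_of_mem_topSingularSpace ha
  have hnorm : ‖A a‖ = ‖A‖ * ‖a‖ := by
    rw [← mul_pow] at hsq
    exact (pow_left_inj₀ (norm_nonneg _) (by positivity) two_ne_zero).1 hsq
  have hlim : inner ℝ (A a) (B a) / (‖A‖ * ‖a‖ ^ 2) ≤ d := by
    refine ge_of_tendsto hd ?_
    filter_upwards [self_mem_nhdsWithin] with t ht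
    have ht : 0 < t := ht
    rw [le_div_iff₀ ht, div_mul_eq_mul_div, div_le_iff₀ (by positivity)]
    have hcs := real_inner_le_norm (A a) ((A + t • B) a)
    have hop := (A + t • B).le_opNorm a
    rw [_root_.add_apply, _root_.smul_apply] at hcs hop
    rw [inner_add_right, real_inner_smul_right, real_inner_self_eq_norm_sq, hsq, hnorm] at hcs
    nlinarith [mul_le_mul_of_nonneg_left hop (by positivity : 0 ≤ ‖A‖ * ‖a‖)]
  rw [div_le_iff₀ (by positivity)] at hlim
  linarith

/-- Second-order upper estimate for the operator norm along a ray. -/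
theorem exists_opNorm_add_smul_le [FiniteDimensional ℝ E] (A B : E →L[ℝ] F) (hA : A ≠ 0) (d : ℝ)
    (hd : Tendsto (fun t : ℝ => (‖A + t • B‖ - ‖A‖) / t) (nhdsWithin 0 (Set.Ioi 0)) (nhds d)) :
    ∃ C : ℝ, ∀ s : ℝ, 0 < s → ‖A + s • B‖ ≤ ‖A‖ + s * d + C * s ^ 2 := by
  have hA' : 0 < ‖A‖ := norm_pos_iff.2 hA
  obtain ⟨δ, hδ, hgap⟩ := exists_gap_topSingularSpace A
  let K := 3 * (‖A‖ * ‖B‖) + ‖A‖ * |d|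
  let M := K ^ 2 / δ + ‖B‖ ^ 2
  refine ⟨M / (2 * ‖A‖), fun s hs => ?_⟩
  have hunit : ∀ x : E, ‖x‖ = 1 →
      ‖(A + s • B) x‖ ^ 2 ≤ ‖A‖ ^ 2 + 2 * s * (‖A‖ * d) + M * s ^ 2 := by
    intro x hx
    obtain ⟨a, ha, b, hb, rfl⟩ := (topSingularSpace A).exists_add_mem_mem_orthogonal x
    have hab : inner ℝ a b = 0 := hb a ha
    have hAab : inner ℝ (A a) (A b) = 0 := by rw [ha b, hab, mul_zero]
    have hpyth : ‖a‖ ^ 2 + ‖b‖ ^ 2 = 1 := by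
      have h := norm_add_sq_real a b
      rw [hx, hab] at h
      linarith
    have ha1 : ‖a‖ ≤ 1 := by nlinarith [norm_nonneg a, sq_nonneg ‖b‖]
    have hb1 : ‖b‖ ≤ 1 := by nlinarith [norm_nonneg b, sq_nonneg ‖a‖]
    have hAx : ‖A (a + b)‖ ^ 2 ≤ ‖A‖ ^ 2 - δ * ‖b‖ ^ 2 := by
      rw [map_add, norm_add_sq_real, hAab, norm_apply_sq_of_mem_topSingularSpace ha]
      nlinarith [hgap b hb]
    have hBx : ‖B (a + b)‖ ^ 2 ≤ ‖B‖ ^ 2 := by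
      simpa [hx] using norm_apply_sq_le B (a + b)
    have hcross : ∀ u v : E, inner ℝ (A u) (B v) ≤ ‖A‖ * ‖B‖ * (‖u‖ * ‖v‖) := fun u v =>
      calc inner ℝ (A u) (B v) ≤ ‖A u‖ * ‖B v‖ := real_inner_le_norm _ _
        _ ≤ (‖A‖ * ‖u‖) * (‖B‖ * ‖v‖) := by
          gcongr
          · exact A.le_opNorm u
          · exact B.le_opNorm v
        _ = ‖A‖ * ‖B‖ * (‖u‖ * ‖v‖) := by ring
    have hcross' : ∀ u v : E, ‖u‖ * ‖v‖ ≤ ‖b‖ → inner ℝ (A u) (B v) ≤ ‖A‖ * ‖B‖ * ‖b‖ :=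
      fun u v huv => (hcross u v).trans (by gcongr)
    have hbn := norm_nonneg b
    have h1 := hcross' a b (by nlinarith)
    have h2 := hcross' b a (by nlinarith)
    have h3 := hcross' b b (by nlinarith)
    have h4 := inner_apply_le_of_mem_topSingularSpace A B hA d hd ha
    have h5 : -d * ‖b‖ ^ 2 ≤ |d| * ‖b‖ :=
      calc -d * ‖b‖ ^ 2 ≤ |d| * ‖b‖ ^ 2 := by gcongr; exact neg_le_abs d
        _ ≤ |d| * ‖b‖ := by gcongr; nlinarith
    have h6 : inner ℝ (A (a + b)) (B (a + b)) ≤ ‖A‖ * d + K * ‖b‖ := by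
      rw [map_add, map_add, inner_add_left, inner_add_right, inner_add_right]
      have ha2 : ‖a‖ ^ 2 = 1 - ‖b‖ ^ 2 := by linarith
      rw [ha2] at h4
      have h7 := mul_le_mul_of_nonneg_left h5 hA'.le
      simp only [K]
      linarith
    have hyoung : 2 * s * (K * ‖b‖) ≤ δ * ‖b‖ ^ 2 + K ^ 2 / δ * s ^ 2 := by
      have hrw : δ * ‖b‖ ^ 2 + K ^ 2 / δ * s ^ 2 - 2 * s * (K * ‖b‖)
          = (δ * ‖b‖ - K * s) ^ 2 / δ := by
        field_simp
        ring
      have : 0 ≤ (δ * ‖b‖ - K * s) ^ 2 / δ := by positivity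
      linarith
    rw [_root_.add_apply, _root_.smul_apply, norm_add_sq_real,
      real_inner_smul_right, norm_smul, mul_pow, Real.norm_eq_abs, sq_abs]
    have h8 := mul_le_mul_of_nonneg_left h6 hs.le
    have h9 := mul_le_mul_of_nonneg_left hBx (sq_nonneg s)
    simp only [M]
    linarith
  obtain ⟨R, hR⟩ : ∃ R, R = ‖A‖ + s * d + M / (2 * ‖A‖) * s ^ 2 := ⟨_, rfl⟩
  have hR2 : ‖A‖ ^ 2 + 2 * s * (‖A‖ * d) + M * s ^ 2 = 2 * ‖A‖ * R - ‖A‖ ^ 2 := by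
    rw [hR]
    field_simp
    ring
  rw [← hR]
  rw [hR2] at hunit
  by_cases hE : ∃ x : E, ‖x‖ = 1
  · obtain ⟨x₀, hx₀⟩ := hE
    have hR0 : 0 ≤ R := by
      have := (sq_nonneg _).trans (hunit x₀ hx₀)
      nlinarith [sq_nonneg ‖A‖]
    refine ContinuousLinearMap.opNorm_le_of_unit_norm hR0 fun x hx => ?_
    refine le_of_sq_le_sq ?_ hR0
    nlinarith [hunit x hx, sq_nonneg (‖A‖ - R)]
  · refine absurd ?_ hA
    ext x
    by_contra hx
    have hx0 : x ≠ 0 := fun h => hx (by simp [h])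
    exact hE ⟨‖x‖⁻¹ • x, norm_smul_inv_norm hx0⟩

end OperatorNorm

section TraceInner

variable {ι κ : Type*} [Fintype ι] [Fintype κ]

theorem minner_add_left (A B C : Matrix ι κ ℝ) : minner (A + B) C = minner A C + minner B C := by
  simp [minner, Matrix.add_mul]

theorem minner_add_right (A B C : Matrix ι κ ℝ) : minner A (B + C) = minner A B + minner A C := by
  simp [minner, Matrix.mul_add]

theorem minner_smul_left (c : ℝ) (A B : Matrix ι κ ℝ) : minner (c • A) B = c * minner A B := by
  simp [minner]

theorem minner_smul_right (c : ℝ) (A B : Matrix ι κ ℝ) : minner A (c • B) = c * minner A B := by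
  simp [minner]

theorem minner_comm (A B : Matrix ι κ ℝ) : minner A B = minner B A := by
  rw [minner, minner, ← Matrix.trace_transpose, Matrix.transpose_mul, Matrix.transpose_transpose]

theorem continuous_minner (A : Matrix ι κ ℝ) : Continuous (minner A) := by
  unfold minner
  fun_prop

end TraceInner

section SpectralNorm

variable {m n : ℕ}

/-- The operator between Euclidean spaces represented by a matrix. -/
noncomputable def matrixCLM : Matrix (Fin m) (Fin n) ℝ →ₗ[ℝ]
    (EuclideanSpace ℝ (Fin n) →L[ℝ] EuclideanSpace ℝ (Fin m)) :=
  LinearMap.toContinuousLinearMap.toLinearMap ∘ₗ (Matrix.toLpLin 2 2).toLinearMap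

theorem matrixCLM_apply (A : Matrix (Fin m) (Fin n) ℝ) (x : EuclideanSpace ℝ (Fin n)) (i : Fin m) :
    matrixCLM A x i = ∑ j, A i j * x j := rfl

theorem matrixCLM_ne_zero {A : Matrix (Fin m) (Fin n) ℝ} (hA : A ≠ 0) : matrixCLM A ≠ 0 := by
  intro h
  refine hA ?_
  ext i j
  have hij := matrixCLM_apply A (EuclideanSpace.single j 1) i
  simpa [h] using hij.symm

theorem specNorm_eq_norm_matrixCLM (A : Matrix (Fin m) (Fin n) ℝ) :
    specNorm A = ‖matrixCLM A‖ := by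
  rw [← ContinuousLinearMap.sSup_sphere_eq_norm, specNorm]
  congr 1
  ext r
  constructor
  · rintro ⟨x, hx, rfl⟩
    refine ⟨WithLp.toLp 2 x, ?_, ?_⟩
    · simp [EuclideanSpace.norm_eq, hx]
    · simp [EuclideanSpace.norm_eq, matrixCLM_apply]
  · rintro ⟨x, hx, rfl⟩
    refine ⟨x.ofLp, ?_, ?_⟩
    · have hx1 : ‖x‖ = 1 := by simpa using hx
      rw [← EuclideanSpace.real_norm_sq_eq, hx1, one_pow]
    · simp [EuclideanSpace.norm_eq, matrixCLM_apply]

theorem specNorm_smul_of_nonneg {c : ℝ} (hc : 0 ≤ c) (A : Matrix (Fin m) (Fin n) ℝ) :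
    specNorm (c • A) = c * specNorm A := by
  rw [specNorm_eq_norm_matrixCLM, specNorm_eq_norm_matrixCLM, map_smul, norm_smul,
    Real.norm_of_nonneg hc]

theorem specNorm_zero : specNorm (0 : Matrix (Fin m) (Fin n) ℝ) = 0 := by
  rw [specNorm_eq_norm_matrixCLM, map_zero, norm_zero]

theorem specNorm_add_le (A B : Matrix (Fin m) (Fin n) ℝ) :
    specNorm (A + B) ≤ specNorm A + specNorm B := by
  simp only [specNorm_eq_norm_matrixCLM, map_add]
  exact norm_add_le _ _

theorem tendsto_dirDeriv_specNorm (P D : Matrix (Fin m) (Fin n) ℝ) :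
    Tendsto (fun t : ℝ => (specNorm (P + t • D) - specNorm P) / t) (nhdsWithin 0 (Set.Ioi 0))
      (nhds (dirDeriv specNorm P D)) := by
  have hconv : ConvexOn ℝ Set.univ (fun t : ℝ => ‖matrixCLM P + t • matrixCLM D‖) := by
    refine ⟨convex_univ, fun x _ y _ a b ha hb hab => ?_⟩
    have hsplit : matrixCLM P + (a • x + b • y) • matrixCLM D
        = a • (matrixCLM P + x • matrixCLM D) + b • (matrixCLM P + y • matrixCLM D) := by
      have hP : matrixCLM P = (a + b) • matrixCLM P := by rw [hab, one_smul]
      nth_rewrite 1 [hP]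
      simp only [smul_eq_mul]
      module
    simp only [hsplit]
    refine (norm_add_le _ _).trans (le_of_eq ?_)
    rw [norm_smul, norm_smul, Real.norm_of_nonneg ha, Real.norm_of_nonneg hb]
    rfl
  have hderiv := hconv.hasDerivWithinAt_rightDeriv_of_mem_interior (x := 0) (by simp)
  rw [hasDerivWithinAt_iff_tendsto_slope' (by simp)] at hderiv
  refine tendsto_nhds_limUnder ⟨_, hderiv.congr fun t => ?_⟩
  have h0 : matrixCLM P + (0 : ℝ) • matrixCLM D = matrixCLM P := by
    rw [← map_smul, zero_smul, map_zero, add_zero]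
  simp only [slope_def_field, specNorm_eq_norm_matrixCLM, map_add, map_smul, h0, sub_zero]

theorem exists_specNorm_add_smul_le {P : Matrix (Fin m) (Fin n) ℝ} (hP : P ≠ 0)
    (D : Matrix (Fin m) (Fin n) ℝ) : ∃ C : ℝ, ∀ s : ℝ, 0 < s →
      specNorm (P + s • D) ≤ specNorm P + s * dirDeriv specNorm P D + C * s ^ 2 := by
  have h := tendsto_dirDeriv_specNorm P D
  simp only [specNorm_eq_norm_matrixCLM, map_add, map_smul] at h ⊢
  exact exists_opNorm_add_smul_le _ _ (matrixCLM_ne_zero hP) _ h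

theorem thetaStar_nonneg (V : Matrix (Fin m) (Fin n) ℝ) : 0 ≤ thetaStar V := by
  refine le_trans (le_of_eq ?_) (le_iSup _ (0 : Matrix (Fin m) (Fin n) ℝ))
  simp [specNorm_zero, minner]

theorem minner_le_specNorm_of_thetaStar_ne_top {V : Matrix (Fin m) (Fin n) ℝ}
    (hV : thetaStar V ≠ ⊤) (X : Matrix (Fin m) (Fin n) ℝ) : minner V X ≤ specNorm X := by
  by_contra! hlt
  refine hV (EReal.eq_top_iff_forall_lt _ |>.2 fun y => ?_)
  obtain ⟨k, hk⟩ := exists_nat_gt (y / (minner V X - specNorm X))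
  rw [div_lt_iff₀ (sub_pos.2 hlt)] at hk
  refine lt_of_lt_of_le (EReal.coe_lt_coe_iff.2 hk) ?_
  refine le_trans (le_of_eq ?_) (le_iSup _ ((k : ℝ) • X))
  rw [minner_smul_right, specNorm_smul_of_nonneg k.cast_nonneg, mul_sub]

theorem thetaStar_eq_zero_of_minner_le {V : Matrix (Fin m) (Fin n) ℝ}
    (hV : ∀ X, minner V X ≤ specNorm X) : thetaStar V = 0 :=
  le_antisymm (iSup_le fun X => by exact_mod_cast sub_nonpos.2 (hV X)) (thetaStar_nonneg V)

theorem thetaStar_eq_zero_or_top (V : Matrix (Fin m) (Fin n) ℝ) :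
    thetaStar V = 0 ∨ thetaStar V = ⊤ :=
  or_iff_not_imp_right.2 fun h =>
    thetaStar_eq_zero_of_minner_le (minner_le_specNorm_of_thetaStar_ne_top h)

theorem minner_le_specNorm_of_mem_subdiff {P W : Matrix (Fin m) (Fin n) ℝ}
    (hW : W ∈ subdiff specNorm P) (X : Matrix (Fin m) (Fin n) ℝ) : minner W X ≤ specNorm X := by
  have h := hW (P + X)
  rw [add_sub_cancel_left] at h
  linarith [specNorm_add_le P X]

theorem minner_eq_specNorm_of_mem_subdiff {P W : Matrix (Fin m) (Fin n) ℝ}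
    (hW : W ∈ subdiff specNorm P) : minner W P = specNorm P := by
  refine le_antisymm (minner_le_specNorm_of_mem_subdiff hW P) ?_
  have h := hW 0
  rw [specNorm_zero, zero_sub, ← neg_one_smul ℝ P, minner_smul_right] at h
  linarith

end SpectralNorm

theorem liminf_eq_zero_and_frequently_of_zero_or_top {α : Type*} {l : Filter α}
    {u : α → EReal} (hu : ∀ᶠ x in l, u x = 0 ∨ u x = ⊤) (htop : liminf u l ≠ ⊤) :
    liminf u l = 0 ∧ ∃ᶠ x in l, u x = 0 := by
  have hfreq : ∃ᶠ x in l, u x = 0 := by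
    intro hne
    refine htop (top_le_iff.1 (le_liminf_of_le (by isBoundedDefault) ?_))
    filter_upwards [hu, hne] with x hx hx0
    exact (hx.resolve_left hx0).ge
  refine ⟨le_antisymm ?_ (le_liminf_of_le (by isBoundedDefault) ?_), hfreq⟩
  · exact liminf_le_of_frequently_le (hfreq.mono fun x hx => hx.le) (by isBoundedDefault)
  · filter_upwards [hu] with x hx
    rcases hx with hx | hx <;> simp [hx]

section EpiDerivatives

variable {m n : ℕ} {W H : Matrix (Fin m) (Fin n) ℝ}

theorem epiDeriv_thetaStar_eq_zero (hW : thetaStar W = 0) (hH : epiDeriv thetaStar W H ≠ ⊤) :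
    epiDeriv thetaStar W H = 0 := by
  refine (liminf_eq_zero_and_frequently_of_zero_or_top ?_ hH).1
  have hpos : ∀ᶠ p : ℝ × Matrix (Fin m) (Fin n) ℝ in
      (nhdsWithin (0 : ℝ) (Set.Ioi 0)) ×ˢ nhds H, 0 < p.1 :=
    tendsto_fst.eventually self_mem_nhdsWithin
  filter_upwards [hpos] with p hp
  rcases thetaStar_eq_zero_or_top (W + p.1 • p.2) with h | h
  · left; simp [h, hW]
  · right; rw [h, hW, sub_zero, EReal.coe_mul_top_of_pos (inv_pos.2 hp)]

theorem epiDeriv2_thetaStar_eq_zero_and_frequently (hW : thetaStar W = 0)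
    (hH : epiDeriv thetaStar W H = 0) {Z : Matrix (Fin m) (Fin n) ℝ}
    (hZ : epiDeriv2 thetaStar W H Z ≠ ⊤) :
    epiDeriv2 thetaStar W H Z = 0 ∧
      ∃ᶠ p : ℝ × Matrix (Fin m) (Fin n) ℝ in (nhdsWithin (0 : ℝ) (Set.Ioi 0)) ×ˢ nhds Z,
        0 < p.1 ∧ thetaStar (W + p.1 • H + (p.1 ^ 2 / 2) • p.2) ≠ ⊤ := by
  have hpos : ∀ᶠ p : ℝ × Matrix (Fin m) (Fin n) ℝ in
      (nhdsWithin (0 : ℝ) (Set.Ioi 0)) ×ˢ nhds Z, 0 < p.1 :=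
    tendsto_fst.eventually self_mem_nhdsWithin
  have htop : ∀ t : ℝ, 0 < t → ((2 / t ^ 2 : ℝ) : EReal) * (⊤ - 0 - t * 0) = ⊤ := by
    intro t ht
    rw [mul_zero, sub_zero, sub_zero, EReal.coe_mul_top_of_pos (by positivity)]
  unfold epiDeriv2 at hZ ⊢
  simp only [hW, hH] at hZ ⊢
  obtain ⟨hzero, hfreq⟩ := liminf_eq_zero_and_frequently_of_zero_or_top (by
    filter_upwards [hpos] with p hp
    rcases thetaStar_eq_zero_or_top (W + p.1 • H + (p.1 ^ 2 / 2) • p.2) with h | h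
    · left; simp [h]
    · right; rw [h, htop _ hp]) hZ
  refine ⟨hzero, (hfreq.and_eventually hpos).mono fun p hp => ⟨hp.2, fun h => ?_⟩⟩
  have h0 := hp.1
  rw [h, htop _ hp.2] at h0
  exact EReal.top_ne_zero h0

/-- A vanishing sigma term yields second-order tangent directions nearly orthogonal to `P`. -/
theorem exists_minner_gt_of_sigmaThetaStar_eq_zero {P : Matrix (Fin m) (Fin n) ℝ}
    (hW : thetaStar W = 0) (hH : epiDeriv thetaStar W H = 0)
    (hsigma : sigmaThetaStar W H P = 0) {ε : ℝ} (hε : 0 < ε) :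
    ∃ Z : Matrix (Fin m) (Fin n) ℝ, -ε < minner P Z ∧
      ∃ᶠ p : ℝ × Matrix (Fin m) (Fin n) ℝ in (nhdsWithin (0 : ℝ) (Set.Ioi 0)) ×ˢ nhds Z,
        0 < p.1 ∧ thetaStar (W + p.1 • H + (p.1 ^ 2 / 2) • p.2) ≠ ⊤ := by
  have hlt : ((-ε : ℝ) : EReal) < sigmaThetaStar W H P := by
    rw [hsigma]
    exact_mod_cast neg_lt_zero.2 hε
  obtain ⟨Z, hZ⟩ := lt_iSup_iff.1 hlt
  have hne : epiDeriv2 thetaStar W H Z ≠ ⊤ := by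
    intro h
    rw [h, EReal.sub_top] at hZ
    exact not_lt_bot hZ
  obtain ⟨hzero, hfreq⟩ := epiDeriv2_thetaStar_eq_zero_and_frequently hW hH hne
  rw [hzero, sub_zero] at hZ
  exact ⟨Z, EReal.coe_lt_coe_iff.1 hZ, hfreq⟩

end EpiDerivatives

/-- Proposition 3.2 (i): if `H ∈ C_{θ*}(W,P)` and the sigma term
`φ*_{(W,H)}(P)` vanishes, then `H` lies in the polar of the critical cone `C_θ(P,W)`. -/
theorem mem_polar_critTheta_of_critThetaStar_sigma_zero {m n : ℕ} (hmn : m ≤ n)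
    (P W : Matrix (Fin m) (Fin n) ℝ) (hP : P ≠ 0)
    (hW : W ∈ subdiff specNorm P)
    (H : Matrix (Fin m) (Fin n) ℝ)
    (hH : H ∈ critThetaStar W P)
    (hsigma : sigmaThetaStar W H P = 0) :
    H ∈ polarCone (critTheta P W) := by
  intro D hD
  have hD : dirDeriv specNorm P D = minner D W := hD
  have hH : epiDeriv thetaStar W H = ((minner H P : ℝ) : EReal) := hH
  have hW0 : thetaStar W = 0 :=
    thetaStar_eq_zero_of_minner_le (minner_le_specNorm_of_mem_subdiff hW)
  have hepi : epiDeriv thetaStar W H = 0 :=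
    epiDeriv_thetaStar_eq_zero hW0 (by rw [hH]; exact EReal.coe_ne_top _)
  have hHP : minner H P = 0 := by
    rw [hepi] at hH
    exact_mod_cast hH.symm
  obtain ⟨C, hC⟩ := exists_specNorm_add_smul_le hP D
  have hbound : ∀ r : ℝ, 0 < r → r * minner H D ≤ C * r ^ 2 := by
    intro r hr
    refine le_of_forall_pos_le_add fun ε hε => ?_
    obtain ⟨Z, hZ, hfreq⟩ := exists_minner_gt_of_sigmaThetaStar_eq_zero hW0 hepi hsigma hε
    have hineq : ∃ᶠ p : ℝ × Matrix (Fin m) (Fin n) ℝ in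
        (nhdsWithin (0 : ℝ) (Set.Ioi 0)) ×ˢ nhds Z,
        r * minner H D + minner P p.2 / 2 + r * p.1 * minner D p.2 / 2 ≤ C * r ^ 2 := by
      refine hfreq.mono fun p ⟨hp, hfin⟩ => ?_
      have h1 := minner_le_specNorm_of_thetaStar_ne_top hfin (P + (r * p.1) • D)
      have h2 := hC (r * p.1) (by positivity)
      rw [hD, ← minner_eq_specNorm_of_mem_subdiff hW, minner_comm D W] at h2
      simp only [minner_add_left, minner_add_right, minner_smul_left, minner_smul_right, hHP,
        minner_comm p.2] at h1
      have h3 : p.1 ^ 2 * (r * minner H D + minner P p.2 / 2 + r * p.1 * minner D p.2 / 2)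
          ≤ p.1 ^ 2 * (C * r ^ 2) := by linarith
      exact le_of_mul_le_mul_left h3 (by positivity)
    have hcont : Continuous fun p : ℝ × Matrix (Fin m) (Fin n) ℝ =>
        r * minner H D + minner P p.2 / 2 + r * p.1 * minner D p.2 / 2 := by
      have hPc := (continuous_minner P).comp (continuous_snd (X := ℝ))
      have hDc := (continuous_minner D).comp (continuous_snd (X := ℝ))
      simp only [Function.comp_def] at hPc hDc
      fun_prop
    have hfilter : (nhdsWithin (0 : ℝ) (Set.Ioi 0)) ×ˢ nhds Z ≤ nhds ((0 : ℝ), Z) := by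
      rw [nhds_prod_eq]
      exact Filter.prod_mono_left _ nhdsWithin_le_nhds
    have hlim := (hcont.tendsto (0, Z)).mono_left hfilter
    have hle := le_of_tendsto_of_frequently hlim hineq
    simp only [mul_zero, zero_mul, zero_div, add_zero] at hle
    linarith
  refine le_of_forall_pos_le_add fun ε hε => ?_
  have hr : 0 < ε / (|C| + 1) := by positivity
  have h := hbound _ hr
  have h1 : minner H D ≤ C * (ε / (|C| + 1)) :=
    le_of_mul_le_mul_left (by linarith) hr
  have h2 : C * (ε / (|C| + 1)) ≤ ε := by
    rw [mul_div_assoc', div_le_iff₀ (by positivity)]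
    nlinarith [le_abs_self C]
  linarith
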